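/- arXiv:1908.01276 — 6 statements merged into one kernel-verified Lean document; each statement's English description precedes it below -/
import Mathlib

section
/- (Lemma 2.2) Let 𝕊 be a bordered space and let p : 𝕄 → 𝕊, q : ℕ → 𝕊 be morphisms of bordered spaces, with q semiproper. Then for every continuous map g : M̊ → N̊ satisfying q̊ ∘ g = p̊ there is a unique morphism of bordered spaces f : 𝕄 → ℕ with f̊ = g and q ∘ f = p. Equivalently, the natural map Hom_{bTop_𝕊}(𝕄, ℕ) → Hom_{Top_S̊}(M̊, N̊) is a bijection. -/
open Set Topology

/-- A map is *proper* if it is continuous and the preimage of every compact set is compact. -/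
def IsCompactlyProper {X Y : Type*} [TopologicalSpace X] [TopologicalSpace Y]
    (f : X → Y) : Prop :=
  Continuous f ∧ ∀ K : Set Y, IsCompact K → IsCompact (f ⁻¹' K)

/-- The graph of a map `f : M̊ → N̊` between the open parts of two bordered spaces,
viewed as a subset of the ambient product `Ĉ_𝕄 × Ĉ_ℕ`. -/
def borderedGraph {A B : Type*} (M : Set A) (N : Set B) (f : M → N) : Set (A × B) :=
  {q | ∃ x : M, q.1 = (x : A) ∧ q.2 = (f x : B)}

/-- A map `f : M̊ → N̊` is a morphism of bordered spaces `(M̊, A) → (N̊, B)` if it is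
continuous and the projection to `A` of the closure of its graph in `A × B` is proper. -/
def IsBorderedHom {A B : Type*} [TopologicalSpace A] [TopologicalSpace B]
    (M : Set A) (N : Set B) (f : M → N) : Prop :=
  Continuous f ∧
    IsCompactlyProper (fun q : closure (borderedGraph M N f) => (q : A × B).1)

/-- A morphism of bordered spaces is *semiproper* if moreover the projection to `B`
of the closure of its graph is proper. -/
def IsSemiproperHom {A B : Type*} [TopologicalSpace A] [TopologicalSpace B]
    (M : Set A) (N : Set B) (f : M → N) : Prop :=
  IsBorderedHom M N f ∧
    IsCompactlyProper (fun q : closure (borderedGraph M N f) => (q : A × B).2)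

/-- The first projection of the closed graph is proper once `f` maps a neighbourhood of each compact
set into a compact set. -/
theorem IsBorderedHom.of_exists_isCompact {A B : Type*} [TopologicalSpace A] [TopologicalSpace B]
    [T2Space A] [T2Space B] {M : Set A} {N : Set B} {f : M → N} (hf : Continuous f)
    (h : ∀ K : Set A, IsCompact K → ∃ U : Set A, IsOpen U ∧ K ⊆ U ∧
      ∃ L : Set B, IsCompact L ∧ ∀ x : M, (x : A) ∈ U → (f x : B) ∈ L) :
    IsBorderedHom M N f := by
  refine ⟨hf, continuous_fst.comp continuous_subtype_val, fun K hK => ?_⟩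
  obtain ⟨U, hU, hKU, L, hL, hfL⟩ := h K hK
  have hsnd : ∀ z ∈ closure (borderedGraph M N f), z.1 ∈ K → z.2 ∈ L := by
    intro z hz hzK
    by_contra hzL
    obtain ⟨w, ⟨hwU, hwL⟩, x, hx₁, hx₂⟩ := mem_closure_iff.1 hz (U ×ˢ Lᶜ)
      (hU.prod hL.isClosed.isOpen_compl) ⟨hKU hzK, hzL⟩
    exact hwL (hx₂ ▸ hfL x (hx₁ ▸ hwU))
  rw [Subtype.isCompact_iff]
  convert (hK.prod hL).inter_left (isClosed_closure (s := borderedGraph M N f)) using 1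
  ext z
  constructor
  · rintro ⟨w, hw, rfl⟩
    exact ⟨w.2, hw, hsnd w w.2 hw⟩
  · rintro ⟨hz, hzK, -⟩
    exact ⟨⟨z, hz⟩, hzK, rfl⟩

/-- A morphism of bordered spaces maps each compact set into a compact set. -/
theorem IsBorderedHom.exists_isCompact {A B : Type*} [TopologicalSpace A] [TopologicalSpace B]
    {M : Set A} {N : Set B} {f : M → N} (hf : IsBorderedHom M N f) {K : Set A}
    (hK : IsCompact K) : ∃ L : Set B, IsCompact L ∧ ∀ x : M, (x : A) ∈ K → (f x : B) ∈ L :=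
  ⟨_, (hf.2.2 K hK).image (continuous_snd.comp continuous_subtype_val), fun x hx =>
    ⟨⟨(x, f x), subset_closure ⟨x, rfl, rfl⟩⟩, hx, rfl⟩⟩

/-- For a semiproper morphism, the preimage of each compact set lies in a compact set. -/
theorem IsSemiproperHom.exists_isCompact {A B : Type*} [TopologicalSpace A] [TopologicalSpace B]
    {M : Set A} {N : Set B} {f : M → N} (hf : IsSemiproperHom M N f) {K : Set B}
    (hK : IsCompact K) : ∃ L : Set A, IsCompact L ∧ ∀ x : M, (f x : B) ∈ K → (x : A) ∈ L :=
  ⟨_, (hf.2.2 K hK).image (continuous_fst.comp continuous_subtype_val), fun x hx =>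
    ⟨⟨(x, f x), subset_closure ⟨x, rfl, rfl⟩⟩, hx, rfl⟩⟩

/-- Lemma 2.2: Let `𝕊` be a bordered space and `p : 𝕄 → 𝕊`,
`q : ℕ → 𝕊` morphisms of bordered spaces with `q` semiproper. Then every continuous
map `g : M̊ → N̊` with `q̊ ∘ g = p̊` underlies a unique morphism of bordered spaces
`f : 𝕄 → ℕ` over `𝕊` with `f̊ = g`; i.e. the natural map
`Hom_{bTop_𝕊}(𝕄, ℕ) → Hom_{Top_S̊}(M̊, N̊)` is a bijection. -/
theorem bordered_hom_over_semiproper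
    {CM CN CS : Type}
    [TopologicalSpace CM] [T2Space CM] [LocallyCompactSpace CM] [SigmaCompactSpace CM]
    [TopologicalSpace CN] [T2Space CN] [LocallyCompactSpace CN] [SigmaCompactSpace CN]
    [TopologicalSpace CS] [T2Space CS] [LocallyCompactSpace CS] [SigmaCompactSpace CS]
    (M : Set CM) (N : Set CN) (S : Set CS)
    (hM : IsOpen M) (hN : IsOpen N) (hS : IsOpen S)
    (p : M → S) (hp : IsBorderedHom M S p)
    (q : N → S) (hq : IsSemiproperHom N S q)
    (g : M → N) (hg : Continuous g) (hcomm : ∀ x, q (g x) = p x) :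
    ∃! f : M → N,
      IsBorderedHom M N f ∧ (∀ x, q (f x) = p x) ∧ ∀ x, f x = g x := by
  refine ⟨g, ⟨.of_exists_isCompact hg fun K hK => ?_, hcomm, fun _ => rfl⟩,
    fun f hf => funext hf.2.2⟩
  obtain ⟨K', hK', hKK'⟩ := exists_compact_superset hK
  obtain ⟨C, hC, hpC⟩ := hp.exists_isCompact hK'
  obtain ⟨L, hL, hqL⟩ := hq.exists_isCompact hC
  exact ⟨interior K', isOpen_interior, hKK', L, hL, fun x hx =>
    hqL _ (hcomm x ▸ hpC x (interior_subset hx))⟩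
end

section
/- (Proposition 2.3, bordered compactification) Let M be a good space and p : (M, M) → 𝕊 a morphism of bordered spaces. Then there exists a bordered space M_∞ with underlying open subset (M_∞)° = M, together with a semiproper morphism p_∞ : M_∞ → 𝕊 whose underlying continuous map is p̊. Moreover, M_∞ is unique up to a unique isomorphism of bordered spaces over 𝕊 inducing the identity on M. -/
open Set Topology

/-- A good space: Hausdorff, locally compact, countable at infinity. -/
structure GoodSpace : Type 1 where
  carrier : Type
  [top : TopologicalSpace carrier]
  [t2 : T2Space carrier]
  [lc : LocallyCompactSpace carrier]
  [sc : SigmaCompactSpace carrier]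

attribute [instance] GoodSpace.top GoodSpace.t2 GoodSpace.lc GoodSpace.sc

/-- The data `(C, j, f)` realizes the bordered compactification of `M` over the
bordered space `𝕊 = (S, B)` relative to `p : M → S̊`: `C` is a good space, `j` embeds
`M` as an open subset of `C`, and `f`, the map induced by `p` on the bordered space
`(j(M), C)`, is a semiproper morphism of bordered spaces to `𝕊`. -/
def IsBorderedCompactification
    (M : Type) [TopologicalSpace M]
    (B : Type) [TopologicalSpace B] (S : Set B) (p : M → S)
    (C : GoodSpace) (j : M → C.carrier) (f : ↥(Set.range j) → ↥S) : Prop :=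
  IsOpenEmbedding j ∧
    (∀ m : M, f ⟨j m, Set.mem_range_self m⟩ = p m) ∧
    IsSemiproperHom (Set.range j) S f

/-- A continuous map restricted to a closed subset is proper as soon as preimages of compact
sets are contained in compact sets. -/
theorem isCompactlyProper_restrict {X Y : Type*} [TopologicalSpace X] [TopologicalSpace Y]
    [T2Space Y] {Z : Set X} (hZ : IsClosed Z) {g : X → Y} (hg : Continuous g)
    (h : ∀ K : Set Y, IsCompact K → ∃ L : Set X, IsCompact L ∧ Z ∩ g ⁻¹' K ⊆ L) :
    IsCompactlyProper (fun q : Z => g q) := by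
  refine ⟨hg.comp continuous_subtype_val, fun K hK => ?_⟩
  obtain ⟨L, hL, hsub⟩ := h K hK
  refine (hZ.isClosedEmbedding_subtypeVal.isCompact_preimage hL).of_isClosed_subset
    (hK.isClosed.preimage (hg.comp continuous_subtype_val)) fun q hq => hsub ⟨q.2, hq⟩

theorem IsCompactlyProper.isCompact_inter_preimage {X Y : Type*} [TopologicalSpace X]
    [TopologicalSpace Y] {Z : Set X} {g : X → Y} (hg : IsCompactlyProper (fun q : Z => g q))
    {K : Set Y} (hK : IsCompact K) : IsCompact (Z ∩ g ⁻¹' K) := by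
  have := (hg.2 K hK).image continuous_subtype_val
  rwa [show (fun q : Z => g q) ⁻¹' K = (↑) ⁻¹' (g ⁻¹' K) from rfl,
    Subtype.image_preimage_coe] at this

/-- If a bordered morphism `f₁` from `M₁` and a semiproper morphism `f₂` from `M₂` have the same
target, every continuous `h : M₁ → M₂` over that target is a bordered morphism. -/
theorem IsSemiproperHom.isBorderedHom_of_comp_eq {A₁ A₂ B : Type*} [TopologicalSpace A₁]
    [TopologicalSpace A₂] [TopologicalSpace B] [T2Space A₁] [LocallyCompactSpace A₁]
    [T2Space A₂] {M₁ : Set A₁} {M₂ : Set A₂} {S : Set B}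
    {f₁ : M₁ → S} {f₂ : M₂ → S} {h : M₁ → M₂} (hf₂ : IsSemiproperHom M₂ S f₂)
    (hf₁ : IsBorderedHom M₁ S f₁) (hh : Continuous h) (hcomp : ∀ x, f₂ (h x) = f₁ x) :
    IsBorderedHom M₁ M₂ h := by
  refine ⟨hh, isCompactlyProper_restrict isClosed_closure continuous_fst fun K hK => ?_⟩
  obtain ⟨K', hK', hKK'⟩ := exists_compact_superset hK
  have hL := (hf₁.2.isCompact_inter_preimage hK').image continuous_snd
  have hL₂ := (hf₂.2.isCompact_inter_preimage hL).image continuous_fst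
  refine ⟨_, hK'.prod hL₂, ?_⟩
  rintro q ⟨hq, hqK⟩
  have hmem : q ∈ closure (borderedGraph M₁ M₂ h ∩ Prod.fst ⁻¹' interior K') := by
    rw [inter_comm]
    exact (isOpen_interior.preimage continuous_fst).inter_closure ⟨hKK' hqK, hq⟩
  refine (closure_minimal ?_ (hK'.prod hL₂).isClosed) hmem
  rintro ⟨a, b⟩ ⟨⟨x, rfl, rfl⟩, hx⟩
  have hxK : (x : A₁) ∈ K' := interior_subset hx
  refine ⟨hxK, ((h x : A₂), (f₁ x : B)), ⟨subset_closure ⟨h x, rfl, by simp [hcomp]⟩, ?_⟩, rfl⟩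
  exact ⟨((x : A₁), (f₁ x : B)), ⟨subset_closure ⟨x, rfl, rfl⟩, hxK⟩, rfl⟩

theorem mem_closure_range_onePoint_graph_iff {M B : Type*} [TopologicalSpace M]
    [TopologicalSpace B] [T2Space B] {p : M → B} (hp : Continuous p) (m : M) (b : B) :
    ((m : OnePoint M), b) ∈ closure (range fun x : M => ((x : OnePoint M), p x)) ↔ b = p m := by
  refine ⟨fun h => ?_, fun h => subset_closure ⟨m, by rw [h]⟩⟩
  have hemb : IsOpenEmbedding (Prod.map ((↑) : M → OnePoint M) (id : B → B)) :=
    OnePoint.isOpenEmbedding_coe.prodMap .id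
  have hmb : (m, b) ∈ closure (range fun x : M => (x, p x)) := by
    rw [hemb.isInducing.closure_eq_preimage_closure_image, ← range_comp]
    exact h
  have hclosed : IsClosed {q : M × B | q.2 = p q.1} :=
    isClosed_eq continuous_snd (hp.comp continuous_fst)
  have hsub : (range fun x : M => (x, p x)) ⊆ {q | q.2 = p q.1} := range_subset_iff.2 fun _ => rfl
  exact closure_minimal hsub hclosed hmb

/-- The bordered compactification is realized by the closure of the graph of `p` in
`OnePoint M × B`. -/
theorem exists_isBorderedCompactification
    (M : Type) [TopologicalSpace M] [T2Space M] [LocallyCompactSpace M]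
    (B : Type) [TopologicalSpace B] [T2Space B] [LocallyCompactSpace B] [SigmaCompactSpace B]
    (S : Set B) (p : M → S) (hp : Continuous p) :
    ∃ (C : GoodSpace) (j : M → C.carrier) (f : ↥(Set.range j) → ↥S),
      IsBorderedCompactification M B S p C j f := by
  let g : M → OnePoint M × B := fun x => ((x : OnePoint M), (p x : B))
  have hpc : Continuous fun x => (p x : B) := continuous_subtype_val.comp hp
  have hgc : Continuous g := OnePoint.continuous_coe.prodMk hpc
  have hZ : IsClosed (closure (range g)) := isClosed_closure
  have : LocallyCompactSpace (closure (range g)) :=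
    hZ.isClosedEmbedding_subtypeVal.locallyCompactSpace
  have : SigmaCompactSpace (closure (range g)) :=
    hZ.isClosedEmbedding_subtypeVal.sigmaCompactSpace
  let j : M → closure (range g) := fun x => ⟨g x, subset_closure ⟨x, rfl⟩⟩
  have hjc : Continuous j := hgc.subtype_mk _
  have hj : IsOpenEmbedding j := by
    refine ⟨.of_comp hjc (continuous_fst.comp continuous_subtype_val)
      OnePoint.isOpenEmbedding_coe.isEmbedding, ?_⟩
    have : range j = (fun c : closure (range g) => c.1.1) ⁻¹' range ((↑) : M → OnePoint M) := by
      ext ⟨⟨x, b⟩, hc⟩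
      constructor
      · rintro ⟨m, hm⟩
        exact ⟨m, congrArg (fun c => c.1.1) hm⟩
      · rintro ⟨m, rfl⟩
        obtain rfl := (mem_closure_range_onePoint_graph_iff hpc m b).1 hc
        exact ⟨m, rfl⟩
    rw [this]
    exact OnePoint.isOpenEmbedding_coe.isOpen_range.preimage
      (continuous_fst.comp continuous_subtype_val)
  let e : M ≃ₜ range j := hj.isEmbedding.toHomeomorph
  have hpe : ∀ m, p (e.symm ⟨j m, mem_range_self m⟩) = p m := fun m =>
    congrArg p (e.symm_apply_apply m)
  have hsnd : Continuous fun c : closure (range g) => c.1.2 :=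
    continuous_snd.comp continuous_subtype_val
  have hgraph : closure (borderedGraph (range j) S (p ∘ e.symm)) ⊆ {q | q.2 = q.1.1.2} := by
    refine closure_minimal ?_ (isClosed_eq continuous_snd (hsnd.comp continuous_fst))
    rintro ⟨c, b⟩ ⟨⟨_, m, rfl⟩, rfl, rfl⟩
    exact congrArg Subtype.val (hpe m)
  refine ⟨⟨closure (range g)⟩, j, p ∘ e.symm, hj, hpe, ⟨hp.comp e.symm.continuous, ?_⟩, ?_⟩
  · refine isCompactlyProper_restrict isClosed_closure continuous_fst fun K hK =>
      ⟨_, hK.image (continuous_id.prodMk hsnd), ?_⟩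
    rintro ⟨c, b⟩ ⟨hq, hc⟩
    exact ⟨c, hc, Prod.ext rfl (hgraph hq).symm⟩
  · refine isCompactlyProper_restrict isClosed_closure continuous_snd fun K hK =>
      ⟨_, (hZ.isClosedEmbedding_subtypeVal.isCompact_preimage
        (isCompact_univ.prod hK)).prod hK, ?_⟩
    rintro ⟨c, b⟩ ⟨hq, hb⟩
    have hcb : b = c.1.2 := hgraph hq
    exact ⟨⟨mem_univ _, hcb ▸ hb⟩, hb⟩

/-- Proposition 2.3: Let `M` be a good space and `p : (M, M) → 𝕊` a
morphism of bordered spaces. Then there exists a bordered compactification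
`M_∞` of `M` over `𝕊`, i.e. a bordered space with underlying open subset `M` together
with a semiproper morphism `p_∞ : M_∞ → 𝕊` whose underlying continuous map is `p̊`;
moreover it is unique up to a unique isomorphism of bordered spaces over `𝕊` inducing
the identity on `M`. -/
theorem bordered_compactification_exists_unique
    (M : Type) [TopologicalSpace M] [T2Space M] [LocallyCompactSpace M]
    [SigmaCompactSpace M]
    (B : Type) [TopologicalSpace B] [T2Space B] [LocallyCompactSpace B]
    [SigmaCompactSpace B]
    (S : Set B) (hS : IsOpen S) (p : M → S)
    (hp : IsBorderedHom (Set.univ : Set M) S (fun m => p (m : M))) :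
    (∃ (C : GoodSpace) (j : M → C.carrier) (f : ↥(Set.range j) → ↥S),
      IsBorderedCompactification M B S p C j f) ∧
    (∀ (C₁ : GoodSpace) (j₁ : M → C₁.carrier) (f₁ : ↥(Set.range j₁) → ↥S)
       (C₂ : GoodSpace) (j₂ : M → C₂.carrier) (f₂ : ↥(Set.range j₂) → ↥S),
      IsBorderedCompactification M B S p C₁ j₁ f₁ →
      IsBorderedCompactification M B S p C₂ j₂ f₂ →
      ∃! h : ↥(Set.range j₁) → ↥(Set.range j₂),
        IsBorderedHom (Set.range j₁) (Set.range j₂) h ∧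
        (∀ m : M, h ⟨j₁ m, Set.mem_range_self m⟩ = ⟨j₂ m, Set.mem_range_self m⟩) ∧
        (∀ x, f₂ (h x) = f₁ x) ∧
        ∃ h' : ↥(Set.range j₂) → ↥(Set.range j₁),
          IsBorderedHom (Set.range j₂) (Set.range j₁) h' ∧
          (∀ x, h' (h x) = x) ∧ (∀ y, h (h' y) = y)) := by
  have hpc : Continuous p := hp.1.comp (continuous_id.subtype_mk fun _ => mem_univ _)
  refine ⟨exists_isBorderedCompactification M B S p hpc, ?_⟩
  rintro C₁ j₁ f₁ C₂ j₂ f₂ ⟨hj₁, hf₁, hs₁⟩ ⟨hj₂, hf₂, hs₂⟩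
  let e₁ : M ≃ₜ range j₁ := hj₁.isEmbedding.toHomeomorph
  let e₂ : M ≃ₜ range j₂ := hj₂.isEmbedding.toHomeomorph
  let e : range j₁ ≃ₜ range j₂ := e₁.symm.trans e₂
  have he : ∀ m, e ⟨j₁ m, mem_range_self m⟩ = ⟨j₂ m, mem_range_self m⟩ := fun m =>
    congrArg e₂ (e₁.symm_apply_apply m)
  have hover : ∀ x, f₂ (e x) = f₁ x := by
    rintro ⟨_, m, rfl⟩
    rw [he, hf₁, hf₂]
  have hover' : ∀ y, f₁ (e.symm y) = f₂ y := fun y => by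
    rw [← hover, e.apply_symm_apply]
  refine ⟨e, ⟨hs₂.isBorderedHom_of_comp_eq hs₁.1 e.continuous hover, he, hover, e.symm,
    hs₁.isBorderedHom_of_comp_eq hs₂.1 e.symm.continuous hover', e.symm_apply_apply,
    e.apply_symm_apply⟩, ?_⟩
  rintro h ⟨-, hh, -⟩
  funext ⟨_, m, rfl⟩
  rw [hh, he]
end

section
/- Let M be a good space, 𝕊 = (S̊, Ĉ_𝕊) a bordered space, and p̊ : M → S̊ a continuous map. On the disjoint union Ĉ := M ⊔ Ĉ_𝕊 declare a set U ⊆ Ĉ open if and only if U ∩ M is open in M and, for every point s ∈ U ∩ Ĉ_𝕊, there exist an open neighborhood V of s in Ĉ_𝕊 and a compact subset K ⊆ M such that V ∪ (p̊⁻¹(V ∩ S̊) ∖ K) ⊆ U. Then this defines a topology on Ĉ; with this topology Ĉ is Hausdorff, locally compact, and countable at infinity; M is an open subspace of Ĉ carrying its original topology; and Ĉ_𝕊 is a closed subspace of Ĉ carrying its original topology. -/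
open Set Topology

/-- The collection of subsets of `M ⊕ B` declared open in the bordered
compactification construction: `U` is open iff `U ∩ M` is open in `M` and every
point `s ∈ U ∩ B` admits an open neighborhood `V` in `B` and a compact `K ⊆ M`
with `V ∪ (p̊⁻¹(V ∩ S) ∖ K) ⊆ U`. -/
def deltaOpen {M B : Type} [TopologicalSpace M] [TopologicalSpace B]
    (S : Set B) (p : M → B) (U : Set (M ⊕ B)) : Prop :=
  IsOpen (Sum.inl ⁻¹' U) ∧
    ∀ s : B, Sum.inr s ∈ U →
      ∃ V : Set B, IsOpen V ∧ s ∈ V ∧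
        ∃ K : Set M, IsCompact K ∧
          (Sum.inr '' V ∪ Sum.inl '' (p ⁻¹' (V ∩ S) \ K)) ⊆ U

/-- The topology on `Ĉ = M ⊔ B` generated by the above collection. -/
def deltaTop {M B : Type} [TopologicalSpace M] [TopologicalSpace B]
    (S : Set B) (p : M → B) : TopologicalSpace (M ⊕ B) :=
  TopologicalSpace.generateFrom {U | deltaOpen S p U}

section Delta

variable {M B : Type} [TopologicalSpace M] [TopologicalSpace B] {S : Set B} {p : M → B}

theorem deltaOpen_univ : deltaOpen S p univ :=
  ⟨isOpen_univ, fun _ _ => ⟨univ, isOpen_univ, mem_univ _, ∅, isCompact_empty, subset_univ _⟩⟩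

theorem deltaOpen.inter {U U' : Set (M ⊕ B)} (hU : deltaOpen S p U) (hU' : deltaOpen S p U') :
    deltaOpen S p (U ∩ U') := by
  refine ⟨hU.1.inter hU'.1, fun s hs => ?_⟩
  obtain ⟨V, hV, hsV, K, hK, hVK⟩ := hU.2 s hs.1
  obtain ⟨V', hV', hsV', K', hK', hVK'⟩ := hU'.2 s hs.2
  refine ⟨V ∩ V', hV.inter hV', ⟨hsV, hsV'⟩, K ∪ K', hK.union hK', ?_⟩
  rintro _ (⟨b, hb, rfl⟩ | ⟨m, ⟨⟨⟨hm, hm'⟩, hmS⟩, hmK⟩, rfl⟩)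
  · exact ⟨hVK (.inl ⟨b, hb.1, rfl⟩), hVK' (.inl ⟨b, hb.2, rfl⟩)⟩
  · exact ⟨hVK (.inr ⟨m, ⟨⟨hm, hmS⟩, fun h => hmK (.inl h)⟩, rfl⟩),
      hVK' (.inr ⟨m, ⟨⟨hm', hmS⟩, fun h => hmK (.inr h)⟩, rfl⟩)⟩

theorem deltaOpen_sUnion {𝒰 : Set (Set (M ⊕ B))} (h : ∀ U ∈ 𝒰, deltaOpen S p U) :
    deltaOpen S p (⋃₀ 𝒰) := by
  refine ⟨?_, ?_⟩
  · rw [preimage_sUnion]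
    exact isOpen_biUnion fun U hU => (h U hU).1
  · rintro s ⟨U, hU, hs⟩
    obtain ⟨V, hV, hsV, K, hK, hVK⟩ := (h U hU).2 s hs
    exact ⟨V, hV, hsV, K, hK, hVK.trans (subset_sUnion_of_mem hU)⟩

theorem isOpen_deltaTop_iff {U : Set (M ⊕ B)} : IsOpen[deltaTop S p] U ↔ deltaOpen S p U := by
  refine ⟨fun h => ?_, fun h => TopologicalSpace.isOpen_generateFrom_of_mem h⟩
  induction h with
  | basic U hU => exact hU
  | univ => exact deltaOpen_univ
  | inter U U' _ _ hU hU' => exact hU.inter hU'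
  | sUnion 𝒰 _ h => exact deltaOpen_sUnion h

theorem deltaOpen_image_inl {U : Set M} (hU : IsOpen U) :
    deltaOpen S p (Sum.inl '' U : Set (M ⊕ B)) :=
  ⟨by rwa [preimage_image_eq _ Sum.inl_injective], fun _ hs => by simp at hs⟩

theorem deltaOpen_compl_image_inl [T2Space M] {K : Set M} (hK : IsCompact K) :
    deltaOpen S p (Sum.inl '' K : Set (M ⊕ B))ᶜ := by
  refine ⟨?_, fun s _ => ⟨univ, isOpen_univ, mem_univ s, K, hK, ?_⟩⟩
  · rw [preimage_compl, preimage_image_eq _ Sum.inl_injective]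
    exact hK.isClosed.isOpen_compl
  · rintro _ (⟨b, -, rfl⟩ | ⟨m, hm, rfl⟩)
    · simp
    · simpa using hm.2

/-- The map `p` extended by the identity is continuous on the bordered compactification. -/
theorem continuous_deltaTop_elim (hp : Continuous p) :
    @Continuous _ _ (deltaTop S p) _ (Sum.elim p id) := by
  let _ := deltaTop S p
  refine continuous_def.2 fun V hV => isOpen_deltaTop_iff.2 ⟨hV.preimage hp, fun s hs =>
    ⟨V, hV, hs, ∅, isCompact_empty, ?_⟩⟩
  rintro _ (⟨b, hb, rfl⟩ | ⟨m, hm, rfl⟩)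
  · exact hb
  · exact hm.1.1

theorem isOpenEmbedding_deltaTop_inl :
    @IsOpenEmbedding M (M ⊕ B) _ (deltaTop S p) Sum.inl := by
  let _ := deltaTop S p
  exact .of_continuous_injective_isOpenMap
    (continuous_def.2 fun U hU => (isOpen_deltaTop_iff.1 hU).1) Sum.inl_injective
    fun U hU => isOpen_deltaTop_iff.2 (deltaOpen_image_inl hU)

theorem isClosedEmbedding_deltaTop_inr (hp : Continuous p) :
    @IsClosedEmbedding B (M ⊕ B) _ (deltaTop S p) Sum.inr := by
  let _ := deltaTop S p
  have hcont : Continuous (Sum.inr : B → M ⊕ B) := by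
    refine continuous_def.2 fun U hU => isOpen_iff_forall_mem_open.2 fun s hs => ?_
    obtain ⟨V, hV, hsV, K, hK, hVK⟩ := (isOpen_deltaTop_iff.1 hU).2 s hs
    exact ⟨V, fun b hb => hVK (.inl ⟨b, hb, rfl⟩), hV, hsV⟩
  refine ⟨.of_comp hcont (continuous_deltaTop_elim hp) .id, ?_⟩
  rw [← isOpen_compl_iff, compl_range_inr]
  exact isOpenEmbedding_deltaTop_inl.isOpen_range

theorem t2Space_deltaTop [T2Space M] [LocallyCompactSpace M] [T2Space B] (hp : Continuous p) :
    @T2Space (M ⊕ B) (deltaTop S p) := by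
  let _ := deltaTop S p
  have hsep : ∀ (m : M) (b : B), ∃ U U' : Set (M ⊕ B), IsOpen U ∧ IsOpen U' ∧
      Sum.inl m ∈ U ∧ Sum.inr b ∈ U' ∧ Disjoint U U' := by
    intro m b
    obtain ⟨K, hK, hmK⟩ := exists_compact_mem_nhds m
    exact ⟨Sum.inl '' interior K, (Sum.inl '' K)ᶜ,
      isOpen_deltaTop_iff.2 (deltaOpen_image_inl isOpen_interior),
      isOpen_deltaTop_iff.2 (deltaOpen_compl_image_inl hK),
      mem_image_of_mem _ (mem_interior_iff_mem_nhds.2 hmK), by simp,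
      disjoint_compl_right.mono_left (image_mono interior_subset)⟩
  refine ⟨?_⟩
  rintro (m | b) (m' | b') hne
  · exact separated_by_isOpenEmbedding isOpenEmbedding_deltaTop_inl fun h => hne (by rw [h])
  · exact hsep m b'
  · obtain ⟨U, U', hU, hU', hm, hb, hd⟩ := hsep m' b
    exact ⟨U', U, hU', hU, hb, hm, hd.symm⟩
  · exact separated_by_continuous (continuous_deltaTop_elim hp) fun h => hne (congrArg _ h)

/-- The map `p` extended by the identity is proper on the bordered compactification. -/
theorem isProperMap_deltaTop_elim [T2Space B] (hp : Continuous p) (hpS : ∀ m, p m ∈ S) :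
    @IsProperMap _ _ (deltaTop S p) _ (Sum.elim p id) := by
  let _ := deltaTop S p
  have hr := continuous_deltaTop_elim (S := S) hp
  refine isProperMap_iff_ultrafilter.2 ⟨hr, fun 𝒰 b hb => ?_⟩
  by_cases h : ∃ K : Set M, IsCompact K ∧ Sum.inl '' K ∈ 𝒰
  · obtain ⟨K, hK, hK𝒰⟩ := h
    obtain ⟨x, -, hx⟩ := isCompact_iff_ultrafilter_le_nhds'.1
      (hK.image isOpenEmbedding_deltaTop_inl.continuous) 𝒰 hK𝒰
    exact ⟨x, tendsto_nhds_unique ((hr.tendsto x).mono_left hx) hb, hx⟩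
  · push Not at h
    refine ⟨Sum.inr b, rfl, le_nhds_iff.2 fun U hbU hU => ?_⟩
    obtain ⟨V, hV, hbV, K, hK, hVK⟩ := (isOpen_deltaTop_iff.1 hU).2 b hbU
    filter_upwards [hb (hV.mem_nhds hbV), Ultrafilter.compl_mem_iff_notMem.2 (h K hK)]
      with x hxV hxK
    rcases x with m | c
    · exact hVK (.inr ⟨m, ⟨⟨hxV, hpS m⟩, fun hm => hxK ⟨m, hm, rfl⟩⟩, rfl⟩)
    · exact hVK (.inl ⟨c, hxV, rfl⟩)

end Delta

/-- Let `M` be a good space, `𝕊 = (S, B)` a bordered space, and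
`p̊ : M → S̊` a continuous map. Then the collection `deltaOpen` is a topology on
`Ĉ = M ⊔ B` (i.e. the topology it generates has exactly these sets as open sets);
with this topology `Ĉ` is Hausdorff, locally compact, and countable at infinity;
`M` is an open subspace of `Ĉ` carrying its original topology; and `B` is a closed
subspace of `Ĉ` carrying its original topology. -/
theorem bordered_compactification_topology
    (M : Type) [TopologicalSpace M] [T2Space M] [LocallyCompactSpace M]
    [SigmaCompactSpace M]
    (B : Type) [TopologicalSpace B] [T2Space B] [LocallyCompactSpace B]
    [SigmaCompactSpace B]
    (S : Set B) (hS : IsOpen S)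
    (p : M → B) (hp : Continuous p) (hpS : ∀ m, p m ∈ S) :
    (∀ U : Set (M ⊕ B), @IsOpen _ (deltaTop S p) U ↔ deltaOpen S p U) ∧
    @T2Space (M ⊕ B) (deltaTop S p) ∧
    @LocallyCompactSpace (M ⊕ B) (deltaTop S p) ∧
    @SigmaCompactSpace (M ⊕ B) (deltaTop S p) ∧
    @IsOpenEmbedding M (M ⊕ B) _ (deltaTop S p) Sum.inl ∧
    @IsClosedEmbedding B (M ⊕ B) _ (deltaTop S p) Sum.inr := by
  let _ := deltaTop S p
  have hr : IsProperMap (Sum.elim p id) := isProperMap_deltaTop_elim hp hpS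
  have ht2 : T2Space (M ⊕ B) := t2Space_deltaTop hp
  have : WeaklyLocallyCompactSpace (M ⊕ B) := ⟨fun x => by
    obtain ⟨L, hL, hxL⟩ := exists_compact_mem_nhds (Sum.elim p id x)
    exact ⟨_, hr.isCompact_preimage hL, hr.continuous.continuousAt hxL⟩⟩
  have hσ : SigmaCompactSpace (M ⊕ B) := ⟨⟨fun n => Sum.elim p id ⁻¹' compactCovering B n,
    fun n => hr.isCompact_preimage (isCompact_compactCovering B n), by
      rw [← preimage_iUnion, iUnion_compactCovering, preimage_univ]⟩⟩
  exact ⟨fun _ => isOpen_deltaTop_iff, ht2, inferInstance, hσ, isOpenEmbedding_deltaTop_inl,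
    isClosedEmbedding_deltaTop_inr hp⟩
end

section
/- Let M be a good space, 𝕊 = (S̊, Ĉ_𝕊) a bordered space, p̊ : M → S̊ a continuous map, and let Ĉ = M ⊔ Ĉ_𝕊 carry the topology in which U ⊆ Ĉ is open iff U ∩ M is open in M and every s ∈ U ∩ Ĉ_𝕊 admits an open neighborhood V in Ĉ_𝕊 and a compact K ⊆ M with V ∪ (p̊⁻¹(V ∩ S̊) ∖ K) ⊆ U. Then the map p̂ : Ĉ → Ĉ_𝕊, defined by p̂(x) = p̊(x) for x ∈ M and p̂(s) = s for s ∈ Ĉ_𝕊, is continuous and proper. -/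
open Set Topology

/-- The inclusion of `M` into `Ĉ` is continuous. -/
theorem continuous_inl_deltaTop {M B : Type} [TopologicalSpace M] [TopologicalSpace B]
    (S : Set B) (p : M → B) :
    @Continuous M (M ⊕ B) _ (deltaTop S p) Sum.inl :=
  continuous_generateFrom_iff.2 fun _ hU => hU.1

/-- The map `p̂ : Ĉ → B` is continuous. -/
theorem continuous_sumElim_deltaTop {M B : Type} [TopologicalSpace M] [TopologicalSpace B]
    (S : Set B) {p : M → B} (hp : Continuous p) :
    @Continuous (M ⊕ B) B (deltaTop S p) _ (Sum.elim p id) := by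
  let := deltaTop S p
  refine ⟨fun V hV => TopologicalSpace.isOpen_generateFrom_of_mem
    ⟨hV.preimage hp, fun s hs => ⟨V, hV, hs, ∅, isCompact_empty, ?_⟩⟩⟩
  rintro _ (⟨b, hb, rfl⟩ | ⟨m, hm, rfl⟩)
  · exact hb
  · exact hm.1.1

/-- An ultrafilter on `Ĉ` that avoids every compact subset of `M` converges to `s ∈ B` as soon as
its image under `p̂` does. -/
theorem ultrafilter_le_nhds_inr_deltaTop {M B : Type} [TopologicalSpace M] [TopologicalSpace B]
    {S : Set B} {p : M → B} (hpS : ∀ m, p m ∈ S) {F : Ultrafilter (M ⊕ B)} {s : B}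
    (hF : ∀ K : Set M, IsCompact K → Sum.inl '' K ∉ F)
    (hs : Filter.Tendsto (Sum.elim p id) F (𝓝 s)) :
    (F : Filter (M ⊕ B)) ≤ @nhds (M ⊕ B) (deltaTop S p) (Sum.inr s) := by
  rw [deltaTop, TopologicalSpace.nhds_generateFrom]
  refine le_iInf₂ fun U hU => Filter.le_principal_iff.2 ?_
  obtain ⟨V, hV, hsV, K, hK, hVU⟩ := hU.2.2 s hU.1
  filter_upwards [hs (hV.mem_nhds hsV), Ultrafilter.compl_mem_iff_notMem.2 (hF K hK)] with x hx hxK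
  rcases x with m | b
  · exact hVU (Or.inr ⟨m, ⟨⟨hx, hpS m⟩, fun hm => hxK ⟨m, hm, rfl⟩⟩, rfl⟩)
  · exact hVU (Or.inl ⟨b, hx, rfl⟩)

/-- Let `M` be a good space, `𝕊 = (S, B)` a bordered space,
`p̊ : M → S̊` a continuous map, and let `Ĉ = M ⊔ B` carry the topology `deltaTop`.
Then the map `p̂ : Ĉ → B`, equal to `p̊` on `M` and to the identity on `B`,
is continuous and proper: the preimage of every compact subset of `B` is compact. -/
theorem bordered_compactification_proper
    (M : Type) [TopologicalSpace M] [T2Space M] [LocallyCompactSpace M]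
    [SigmaCompactSpace M]
    (B : Type) [TopologicalSpace B] [T2Space B] [LocallyCompactSpace B]
    [SigmaCompactSpace B]
    (S : Set B) (hS : IsOpen S)
    (p : M → B) (hp : Continuous p) (hpS : ∀ m, p m ∈ S) :
    @Continuous (M ⊕ B) B (deltaTop S p) _ (Sum.elim p id) ∧
    ∀ K : Set B, IsCompact K →
      @IsCompact (M ⊕ B) (deltaTop S p) (Sum.elim p id ⁻¹' K) := by
  let := deltaTop S p
  refine ⟨continuous_sumElim_deltaTop S hp, fun K hK => ?_⟩
  refine isCompact_iff_ultrafilter_le_nhds.2 fun F hFK => ?_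
  have hFK' : Sum.elim p id ⁻¹' K ∈ F := Filter.le_principal_iff.1 hFK
  by_cases hF : ∃ L : Set M, IsCompact L ∧ Sum.inl '' L ∈ F
  · obtain ⟨L, hL, hLF⟩ := hF
    have hcpt : IsCompact (Sum.inl '' (L ∩ p ⁻¹' K) : Set (M ⊕ B)) :=
      (hL.inter_right (hK.isClosed.preimage hp)).image (continuous_inl_deltaTop S p)
    have hmem : Sum.inl '' (L ∩ p ⁻¹' K) ∈ F := by
      filter_upwards [hLF, hFK']
      rintro _ ⟨m, hm, rfl⟩ hmK
      exact ⟨m, ⟨hm, hmK⟩, rfl⟩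
    obtain ⟨_, ⟨m, hm, rfl⟩, hle⟩ := hcpt.ultrafilter_le_nhds F (Filter.le_principal_iff.2 hmem)
    exact ⟨Sum.inl m, hm.2, hle⟩
  · push Not at hF
    obtain ⟨s, hsK, hs⟩ := hK.ultrafilter_le_nhds (F.map (Sum.elim p id))
      (Filter.le_principal_iff.2 hFK')
    exact ⟨Sum.inr s, hsK, ultrafilter_le_nhds_inr_deltaTop hpS hF hs⟩
end

section
/- Let |·| denote the Euclidean norm on ℝ^m. The map r : ℝ^m × ℝ^n × ℝ_{≥0} → ℝ^m × ℝ^n × ℝ defined by r(v, y, s) = (sv, y, s − |v|) is a proper continuous map: the preimage under r of every compact subset of ℝ^m × ℝ^n × ℝ is compact. -/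
open Set Topology

/-- The map `r : ℝ^m × ℝ^n × ℝ_{≥0} → ℝ^m × ℝ^n × ℝ`, `r(v, y, s) = (sv, y, s − |v|)`,
where `|·|` is the Euclidean norm on `ℝ^m`. -/
noncomputable def rMap (m n : ℕ)
    (q : EuclideanSpace ℝ (Fin m) × EuclideanSpace ℝ (Fin n) × ↥(Set.Ici (0 : ℝ))) :
    EuclideanSpace ℝ (Fin m) × EuclideanSpace ℝ (Fin n) × ℝ :=
  ((q.2.2 : ℝ) • q.1, q.2.1, (q.2.2 : ℝ) - ‖q.1‖)

/-- the map `r(v, y, s) = (sv, y, s − |v|)` from `ℝ^m × ℝ^n × ℝ_{≥0}`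
to `ℝ^m × ℝ^n × ℝ` is a proper continuous map: the preimage of every compact subset
is compact. -/
theorem rMap_continuous_proper (m n : ℕ) :
    Continuous (rMap m n) ∧
      ∀ K : Set (EuclideanSpace ℝ (Fin m) × EuclideanSpace ℝ (Fin n) × ℝ),
        IsCompact K → IsCompact (rMap m n ⁻¹' K) := by
  have hcont : Continuous (rMap m n) := by
    unfold rMap
    fun_prop
  refine ⟨hcont, fun K hK => ?_⟩
  obtain ⟨C, hC⟩ := hK.isBounded.exists_norm_le
  have hs : IsCompact ((↑) ⁻¹' Icc (0 : ℝ) (C + 1) : Set (Ici (0 : ℝ))) :=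
    isClosed_Ici.isClosedEmbedding_subtypeVal.isCompact_preimage isCompact_Icc
  refine (((isCompact_closedBall 0 (2 * C + 1)).prod
    ((isCompact_closedBall 0 C).prod hs))).of_isClosed_subset (hK.isClosed.preimage hcont) ?_
  rintro ⟨v, y, s, hs0⟩ hq
  have hs0 : 0 ≤ s := hs0
  have hbound := hC _ hq
  simp only [rMap, norm_prod_le_iff, norm_smul, Real.norm_eq_abs, abs_of_nonneg hs0,
    abs_le] at hbound
  obtain ⟨hsv, hy, hlow, hupp⟩ := hbound
  have hsC : s ≤ C + 1 := by
    by_contra! h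
    nlinarith [norm_nonneg y]
  simp only [mem_prod, mem_closedBall_zero_iff, mem_preimage, mem_Icc]
  exact ⟨by linarith, hy, hs0, hsC⟩
end

section
/- Let |·| denote the Euclidean norm on ℝ^m. The map r(v, y, s) = (sv, y, s − |v|) restricts to a homeomorphism from ℝ^m × ℝ^n × ℝ_{>0} onto the open subset U := (ℝ^m × ℝ^n × ℝ) ∖ ({0} × ℝ^n × ℝ_{≤0}); explicitly, for each (x, y, t) with (x, t) ≠ (0, t) for t ≤ 0 (i.e. x ≠ 0 or t > 0) there is a unique s > 0 with s² − ts = |x|, namely s = (t + √(t² + 4|x|))/2, and the inverse map (x, y, t) ↦ (x/s, y, s) is continuous. -/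
open Set Topology

/-- The restriction of `r(v, y, s) = (sv, y, s − |v|)` to `ℝ^m × ℝ^n × ℝ_{>0}`. -/
noncomputable def rMapPos (m n : ℕ)
    (q : EuclideanSpace ℝ (Fin m) × EuclideanSpace ℝ (Fin n) × ↥(Set.Ioi (0 : ℝ))) :
    EuclideanSpace ℝ (Fin m) × EuclideanSpace ℝ (Fin n) × ℝ :=
  ((q.2.2 : ℝ) • q.1, q.2.1, (q.2.2 : ℝ) - ‖q.1‖)

/-- The open subset `U = (ℝ^m × ℝ^n × ℝ) ∖ ({0} × ℝ^n × ℝ_{≤0})`. -/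
def Uset (m n : ℕ) : Set (EuclideanSpace ℝ (Fin m) × EuclideanSpace ℝ (Fin n) × ℝ) :=
  {q | q.1 ≠ 0 ∨ 0 < q.2.2}

/-- The explicit value `s = (t + √(t² + 4|x|))/2` attached to `(x, y, t)`. -/
noncomputable def sVal (m n : ℕ)
    (q : EuclideanSpace ℝ (Fin m) × EuclideanSpace ℝ (Fin n) × ℝ) : ℝ :=
  (q.2.2 + Real.sqrt (q.2.2 ^ 2 + 4 * ‖q.1‖)) / 2

theorem add_sqrt_sq_add_pos {t a : ℝ} (ha : 0 ≤ a) (h : a ≠ 0 ∨ 0 < t) :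
    0 < t + √(t ^ 2 + 4 * a) := by
  rcases h with h | h
  · have ha' : 0 < a := lt_of_le_of_ne ha h.symm
    have : |t| < √(t ^ 2 + 4 * a) := by
      rw [← Real.sqrt_sq_eq_abs]
      exact Real.sqrt_lt_sqrt (sq_nonneg t) (by linarith)
    linarith [neg_abs_le t]
  · positivity

theorem sVal_pos {m n : ℕ} {q : EuclideanSpace ℝ (Fin m) × EuclideanSpace ℝ (Fin n) × ℝ}
    (hq : q ∈ Uset m n) : 0 < sVal m n q :=
  half_pos (add_sqrt_sq_add_pos (norm_nonneg q.1) (hq.imp_left norm_ne_zero_iff.mpr))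

theorem sVal_sq_sub {m n : ℕ} (q : EuclideanSpace ℝ (Fin m) × EuclideanSpace ℝ (Fin n) × ℝ) :
    sVal m n q ^ 2 - q.2.2 * sVal m n q = ‖q.1‖ := by
  have h : √(q.2.2 ^ 2 + 4 * ‖q.1‖) ^ 2 = q.2.2 ^ 2 + 4 * ‖q.1‖ := Real.sq_sqrt (by positivity)
  unfold sVal
  linear_combination h / 4

theorem eq_of_sq_sub_mul_eq {t a s s' : ℝ} (ha : 0 ≤ a) (hs : 0 < s) (hs' : 0 < s')
    (h : s ^ 2 - t * s = a) (h' : s' ^ 2 - t * s' = a) : s = s' := by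
  have hfac : (s - s') * (s + s' - t) = 0 := by linear_combination h - h'
  rcases mul_eq_zero.mp hfac with h₀ | h₀
  · exact sub_eq_zero.mp h₀
  · have : s * s' = -a := by linear_combination s * h₀ - h
    linarith [mul_pos hs hs']

theorem continuous_sVal (m n : ℕ) : Continuous (sVal m n) := by
  unfold sVal
  fun_prop

theorem isOpen_Uset (m n : ℕ) : IsOpen (Uset m n) :=
  (isOpen_ne_fun continuous_fst continuous_const).union
    (isOpen_lt continuous_const (continuous_snd.comp continuous_snd))

theorem rMapPos_mem_Uset {m n : ℕ}
    (q : EuclideanSpace ℝ (Fin m) × EuclideanSpace ℝ (Fin n) × ↥(Set.Ioi (0 : ℝ))) :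
    rMapPos m n q ∈ Uset m n := by
  obtain ⟨v, y, s, hs : 0 < s⟩ := q
  by_cases hv : v = 0
  · right
    simpa [rMapPos, hv] using hs
  · left
    exact smul_ne_zero hs.ne' hv

theorem sVal_rMapPos {m n : ℕ}
    (q : EuclideanSpace ℝ (Fin m) × EuclideanSpace ℝ (Fin n) × ↥(Set.Ioi (0 : ℝ))) :
    sVal m n (rMapPos m n q) = q.2.2 := by
  refine eq_of_sq_sub_mul_eq (norm_nonneg _) (sVal_pos (rMapPos_mem_Uset q)) q.2.2.2
    (sVal_sq_sub _) ?_
  have hs : (0 : ℝ) < q.2.2 := q.2.2.2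
  simp only [rMapPos, norm_smul, Real.norm_of_nonneg hs.le]
  ring

/-- The map `(v, y, s) ↦ (sv, y, s − |v|)` as a homeomorphism onto `U`, with inverse
`(x, y, t) ↦ (x/s, y, s)`. -/
noncomputable def rMapPosHomeomorph (m n : ℕ) :
    (EuclideanSpace ℝ (Fin m) × EuclideanSpace ℝ (Fin n) × ↥(Set.Ioi (0 : ℝ))) ≃ₜ
      ↥(Uset m n) where
  toFun q := ⟨rMapPos m n q, rMapPos_mem_Uset q⟩
  invFun q := ((sVal m n q)⁻¹ • q.1.1, q.1.2.1, ⟨sVal m n q, sVal_pos q.2⟩)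
  left_inv q := by
    have hs : (q.2.2 : ℝ) ≠ 0 := ne_of_gt q.2.2.2
    refine Prod.ext ?_ (Prod.ext rfl (Subtype.ext (sVal_rMapPos q)))
    simp only [sVal_rMapPos]
    exact inv_smul_smul₀ hs q.1
  right_inv q := by
    have hs := sVal_pos q.2
    refine Subtype.ext (Prod.ext (smul_inv_smul₀ hs.ne' q.1.1) (Prod.ext rfl ?_))
    simp only [rMapPos, norm_smul, norm_inv, Real.norm_of_nonneg hs.le]
    rw [← sVal_sq_sub q.1]
    field_simp
    ring
  continuous_toFun := by
    unfold rMapPos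
    fun_prop
  continuous_invFun := by
    have hs : Continuous fun q : Uset m n ↦ sVal m n q :=
      (continuous_sVal m n).comp continuous_subtype_val
    have hinv := hs.inv₀ fun q ↦ (sVal_pos q.2).ne'
    exact (hinv.smul (by fun_prop)).prodMk (Continuous.prodMk (by fun_prop) (hs.subtype_mk _))

/-- `r(v, y, s) = (sv, y, s − |v|)` restricts to a homeomorphism from
`ℝ^m × ℝ^n × ℝ_{>0}` onto the open subset `U = (ℝ^m × ℝ^n × ℝ) ∖ ({0} × ℝ^n × ℝ_{≤0})`:
for each `(x, y, t) ∈ U` there is a unique `s > 0` with `s² − ts = |x|`, namely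
`s = (t + √(t² + 4|x|))/2`, and the inverse map `(x, y, t) ↦ (x/s, y, s)` is
continuous. -/
theorem rMapPos_homeomorphism (m n : ℕ) :
    IsOpen (Uset m n) ∧
    (∀ q ∈ Uset m n, ∃! s : ℝ, 0 < s ∧ s ^ 2 - q.2.2 * s = ‖q.1‖) ∧
    (∀ q ∈ Uset m n,
      0 < sVal m n q ∧ (sVal m n q) ^ 2 - q.2.2 * sVal m n q = ‖q.1‖) ∧
    ∃ h : (EuclideanSpace ℝ (Fin m) × EuclideanSpace ℝ (Fin n) × ↥(Set.Ioi (0 : ℝ)))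
        ≃ₜ ↥(Uset m n),
      (∀ q, ((h q : EuclideanSpace ℝ (Fin m) × EuclideanSpace ℝ (Fin n) × ℝ))
          = rMapPos m n q) ∧
      (∀ q : ↥(Uset m n),
        (((h.symm q).2.2 : ℝ) = sVal m n (q : _)) ∧
        (h.symm q).1 = (sVal m n (q : _))⁻¹ •
          (q : EuclideanSpace ℝ (Fin m) × EuclideanSpace ℝ (Fin n) × ℝ).1 ∧
        (h.symm q).2.1
          = (q : EuclideanSpace ℝ (Fin m) × EuclideanSpace ℝ (Fin n) × ℝ).2.1) := by
  refine ⟨isOpen_Uset m n, fun q hq ↦ ?_, fun q hq ↦ ⟨sVal_pos hq, sVal_sq_sub q⟩,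
    rMapPosHomeomorph m n, fun _ ↦ rfl, fun _ ↦ ⟨rfl, rfl, rfl⟩⟩
  exact ⟨sVal m n q, ⟨sVal_pos hq, sVal_sq_sub q⟩, fun s hs ↦
    eq_of_sq_sub_mul_eq (norm_nonneg q.1) hs.1 (sVal_pos hq) hs.2 (sVal_sq_sub q)⟩
end
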